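/- Let (L,T,R) be a Girard quantum triad. Then for all l ∈ L, r ∈ R, t ∈ T and every α ∈ End_T(L): α(t·l) ≤ r^⊥ if and only if α(l) ≤ (r·t)^⊥. Consequently π(l, (r·t)^⊥) = π(t·l, r^⊥), where π(l,l') denotes the pointwise supremum of {α' ∈ End_T(L) : α'(l) ≤ l'}. -/

import Mathlib

/-- A quantum triad `(L,T,R)`: a quantale `T`, a left `T`-module `L`,
a right `T`-module `R`, and a pairing `L × R → T`, all bimorphisms
(preserving arbitrary suprema in each variable) and satisfying the five
associative laws (TTT, TTL, RTT, LRT, TLR). -/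
structure Triad (L T R : Type*)
    [CompleteLattice L] [CompleteLattice T] [CompleteLattice R] where
  tmul : T → T → T
  smulL : T → L → L
  smulR : R → T → R
  pair : L → R → T
  tmul_sSup_left : ∀ (s : Set T) (b : T), tmul (sSup s) b = ⨆ a ∈ s, tmul a b
  tmul_sSup_right : ∀ (a : T) (s : Set T), tmul a (sSup s) = ⨆ b ∈ s, tmul a b
  smulL_sSup_left : ∀ (s : Set T) (l : L), smulL (sSup s) l = ⨆ t ∈ s, smulL t l
  smulL_sSup_right : ∀ (t : T) (s : Set L), smulL t (sSup s) = ⨆ l ∈ s, smulL t l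
  smulR_sSup_left : ∀ (s : Set R) (t : T), smulR (sSup s) t = ⨆ r ∈ s, smulR r t
  smulR_sSup_right : ∀ (r : R) (s : Set T), smulR r (sSup s) = ⨆ t ∈ s, smulR r t
  pair_sSup_left : ∀ (s : Set L) (r : R), pair (sSup s) r = ⨆ l ∈ s, pair l r
  pair_sSup_right : ∀ (l : L) (s : Set R), pair l (sSup s) = ⨆ r ∈ s, pair l r
  tmul_assoc : ∀ a b c : T, tmul (tmul a b) c = tmul a (tmul b c)
  smulL_assoc : ∀ (t t' : T) (l : L), smulL (tmul t t') l = smulL t (smulL t' l)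
  smulR_assoc : ∀ (r : R) (t t' : T), smulR (smulR r t) t' = smulR r (tmul t t')
  pair_smulR : ∀ (l : L) (r : R) (t : T), tmul (pair l r) t = pair l (smulR r t)
  smulL_pair : ∀ (t : T) (l : L) (r : R), pair (smulL t l) r = tmul t (pair l r)

variable {L T R : Type*} [CompleteLattice L] [CompleteLattice T] [CompleteLattice R]

/-- `Q₁`: pairs `(α,β)` of suprema-preserving `T`-equivariant endomaps of `L`
resp. `R` satisfying `α(l)·r = l·β(r)`. -/
def Triad.Q1 (τ : Triad L T R) : Set ((L → L) × (R → R)) :=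
  fun p =>
    (∀ s : Set L, p.1 (sSup s) = ⨆ l ∈ s, p.1 l) ∧
    (∀ (t : T) (l : L), p.1 (τ.smulL t l) = τ.smulL t (p.1 l)) ∧
    (∀ s : Set R, p.2 (sSup s) = ⨆ r ∈ s, p.2 r) ∧
    (∀ (r : R) (t : T), p.2 (τ.smulR r t) = τ.smulR (p.2 r) t) ∧
    (∀ (l : L) (r : R), τ.pair (p.1 l) r = τ.pair l (p.2 r))

/-- Multiplication on `Q₁`: `(α,β)·(α',β') = (α'∘α, β∘β')`. -/
def q1mul (p q : (L → L) × (R → R)) : (L → L) × (R → R) :=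
  (q.1 ∘ p.1, p.2 ∘ q.2)

/-- `⟨r,l⟩ = (l' ↦ (l'·r)·l, r' ↦ r·(l·r'))`. -/
def Triad.rl (τ : Triad L T R) (r : R) (l : L) : (L → L) × (R → R) :=
  (fun l' => τ.smulL (τ.pair l' r) l, fun r' => τ.smulR r (τ.pair l r'))

/-- `l^⊥ = ⋁{r : l·r ≤ d}`. -/
def lperp (τ : Triad L T R) (d : T) (l : L) : R := sSup {r : R | τ.pair l r ≤ d}

/-- `r^⊥ = ⋁{l : l·r ≤ d}`. -/
def rperp (τ : Triad L T R) (d : T) (r : R) : L := sSup {l : L | τ.pair l r ≤ d}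

/-- `d` is a Girard element: cyclic, the pairing is represented by the two perps,
and the perps are mutually inverse. -/
def Triad.GirardElem (τ : Triad L T R) (d : T) : Prop :=
  (∀ t t' : T, τ.tmul t t' ≤ d ↔ τ.tmul t' t ≤ d) ∧
  (∀ (l : L) (r : R), τ.pair l r ≤ d ↔ r ≤ lperp τ d l) ∧
  (∀ (l : L) (r : R), τ.pair l r ≤ d ↔ l ≤ rperp τ d r) ∧
  (∀ l : L, rperp τ d (lperp τ d l) = l) ∧
  (∀ r : R, lperp τ d (rperp τ d r) = r)

/-- `End_T(L)`: suprema-preserving `T`-equivariant endomaps of `L`. -/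
def EndTL (τ : Triad L T R) : Set (L → L) :=
  fun α => (∀ s : Set L, α (sSup s) = ⨆ l ∈ s, α l) ∧
    ∀ (t : T) (l : L), α (τ.smulL t l) = τ.smulL t (α l)

/-- `π(l,l')`: the pointwise supremum of `{α' ∈ End_T(L) : α'(l) ≤ l'}`. -/
def piMap (τ : Triad L T R) (l l' : L) : L → L :=
  fun x => ⨆ α ∈ {a ∈ EndTL τ | a l ≤ l'}, α x

/-- Equivariance of `α` moves `t` across the pairing, up to cyclicity of `d`. -/
theorem map_smulL_le_rperp_iff (τ : Triad L T R) {d : T} (hd : τ.GirardElem d)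
    {α : L → L} (hα : α ∈ EndTL τ) (l : L) (r : R) (t : T) :
    α (τ.smulL t l) ≤ rperp τ d r ↔ α l ≤ rperp τ d (τ.smulR r t) := by
  rw [← hd.2.2.1, ← hd.2.2.1, hα.2, τ.smulL_pair, ← τ.pair_smulR, hd.1]

/-- In a Girard triad, for all `l`, `r`, `t` and `α ∈ End_T(L)`:
`α(t·l) ≤ r^⊥ ↔ α(l) ≤ (r·t)^⊥`; consequently `π(l,(r·t)^⊥) = π(t·l,r^⊥)`. -/
theorem stmt15 (τ : Triad L T R) (d : T) (hd : τ.GirardElem d) :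
    (∀ (l : L) (r : R) (t : T), ∀ α ∈ EndTL τ,
      (α (τ.smulL t l) ≤ rperp τ d r ↔ α l ≤ rperp τ d (τ.smulR r t))) ∧
    (∀ (l : L) (r : R) (t : T),
      piMap τ l (rperp τ d (τ.smulR r t)) = piMap τ (τ.smulL t l) (rperp τ d r)) := by
  refine ⟨fun l r t α hα => map_smulL_le_rperp_iff τ hd hα l r t, fun l r t => ?_⟩
  have h : {a ∈ EndTL τ | a l ≤ rperp τ d (τ.smulR r t)} =
      {a ∈ EndTL τ | a (τ.smulL t l) ≤ rperp τ d r} :=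
    Set.ext fun _ => and_congr_right fun ha => (map_smulL_le_rperp_iff τ hd ha l r t).symm
  unfold piMap
  rw [h]
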